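/- (Demonic choice) For every valuation ε, pGCL programs s1 and s2, expectation lower bound p, and pDL state formula φ: ε ⊨ [s1]_p φ and ε ⊨ [s2]_p φ if and only if ε ⊨ [s1 ⊓ s2]_p φ. -/

import Mathlib

namespace PDL

/-- Program variables. -/
abbrev Var := String

/-- Values: integers or booleans. -/
inductive Value where
  | int : ℤ → Value
  | bool : Bool → Value
  deriving DecidableEq

/-- A valuation maps program variables to values. -/
abbrev Valuation := Var → Value

/-- pGCL statements (expressions are embedded shallowly as functions of the valuation). -/
inductive Stmt : Type where
  | skip : Stmt
  | assign : Var → (Valuation → Value) → Stmt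
  | seq : Stmt → Stmt → Stmt
  | demon : Stmt → Stmt → Stmt
  | prob : (Valuation → ℝ) → Stmt → Stmt → Stmt
  | ite : (Valuation → Bool) → Stmt → Stmt → Stmt
  | while : (Valuation → Bool) → Stmt → Stmt

/-- MDP states: a valuation together with the remaining program.  ⟨ε, skip⟩ is final. -/
abbrev State := Valuation × Stmt

/-- A (positional) policy resolves each demonic choice state to one of its branches
    (`true` = left branch, `false` = right branch). -/
abbrev Policy := State → Bool

/-- The probabilistic transition relation of the MDP semantics, under policy `π`. -/
inductive Step (π : Policy) : State → ℝ → State → Prop where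
  | assign {ε : Valuation} {x : Var} {e : Valuation → Value} :
      Step π (ε, .assign x e) 1 (Function.update ε x (e ε), .skip)
  | seqSkip {ε : Valuation} {s₂ : Stmt} {p : ℝ} {σ' : State} :
      Step π (ε, s₂) p σ' → Step π (ε, .seq .skip s₂) p σ'
  | seqStep {ε ε' : Valuation} {s₁ s₂ s' : Stmt} {p : ℝ} :
      Step π (ε, s₁) p (ε', s') → Step π (ε, .seq s₁ s₂) p (ε', .seq s' s₂)
  | demonL {ε : Valuation} {s₁ s₂ : Stmt} :
      π (ε, .demon s₁ s₂) = true → Step π (ε, .demon s₁ s₂) 1 (ε, s₁)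
  | demonR {ε : Valuation} {s₁ s₂ : Stmt} :
      π (ε, .demon s₁ s₂) = false → Step π (ε, .demon s₁ s₂) 1 (ε, s₂)
  | iteT {ε : Valuation} {e : Valuation → Bool} {s₁ s₂ : Stmt} :
      e ε = true → Step π (ε, .ite e s₁ s₂) 1 (ε, s₁)
  | iteF {ε : Valuation} {e : Valuation → Bool} {s₁ s₂ : Stmt} :
      e ε = false → Step π (ε, .ite e s₁ s₂) 1 (ε, s₂)
  | probL {ε : Valuation} {e : Valuation → ℝ} {s₁ s₂ : Stmt} :
      0 ≤ e ε → e ε ≤ 1 → Step π (ε, .prob e s₁ s₂) (e ε) (ε, s₁)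
  | probR {ε : Valuation} {e : Valuation → ℝ} {s₁ s₂ : Stmt} :
      0 ≤ e ε → e ε ≤ 1 → Step π (ε, .prob e s₁ s₂) (1 - e ε) (ε, s₂)
  | whileT {ε : Valuation} {e : Valuation → Bool} {s : Stmt} :
      e ε = true → Step π (ε, .while e s) 1 (ε, .seq s (.while e s))
  | whileF {ε : Valuation} {e : Valuation → Bool} {s : Stmt} :
      e ε = false → Step π (ε, .while e s) 1 (ε, .skip)

/-- Paths under policy `π` from a state to a final state `⟨ε, skip⟩`. -/
inductive Paths (π : Policy) : State → Type where
  | nil (ε : Valuation) : Paths π (ε, .skip)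
  | cons {σ σ' : State} (p : ℝ) (h : Step π σ p σ') (rest : Paths π σ') : Paths π σ

/-- The probability of a path: the product of its transition probabilities. -/
noncomputable def Paths.prob {π : Policy} : {σ : State} → Paths π σ → ℝ
  | _, .nil _ => 1
  | _, .cons p _ rest => p * rest.prob

/-- The final valuation of a path. -/
def Paths.finalVal {π : Policy} : {σ : State} → Paths π σ → Valuation
  | _, .nil ε => ε
  | _, .cons _ _ rest => rest.finalVal

/-- Expected value of reward `r` (on final valuations) from state `σ` under policy `π`:
    the sum over all paths of the path probability times the reward at the final state. -/
noncomputable def expVal (π : Policy) (σ : State) (r : Valuation → ℝ) : ℝ :=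
  ∑' ρ : Paths π σ, ρ.prob * r ρ.finalVal

/-- Expectation of reward `r` from state `σ`: the infimum over all policies of
    the expected value. -/
noncomputable def expectation (σ : State) (r : Valuation → ℝ) : ℝ :=
  ⨅ π : Policy, expVal π σ r

open Classical in
/-- The characteristic (indicator) function of a state formula. -/
noncomputable def char (φ : Valuation → Prop) : Valuation → ℝ :=
  fun ε => if φ ε then 1 else 0

/-- pDL box satisfaction: `ε ⊨ [s]_p φ` iff `p ε ≤ E_⟨ε,s⟩[[φ]]`. -/
def sat (ε : Valuation) (s : Stmt) (p : Valuation → ℝ) (φ : Valuation → Prop) : Prop :=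
  p ε ≤ expectation (ε, s) (char φ)


/-- The statement `D` is not one of the demonic choices occurring in the program. -/
def NoOcc (D : Stmt) : Stmt → Prop
  | .skip => True
  | .assign _ _ => True
  | .seq a b => NoOcc D a ∧ NoOcc D b
  | .demon a b => Stmt.demon a b ≠ D ∧ NoOcc D a ∧ NoOcc D b
  | .prob _ a b => NoOcc D a ∧ NoOcc D b
  | .ite _ a b => NoOcc D a ∧ NoOcc D b
  | .while _ a => NoOcc D a

theorem noOcc_of_size (D : Stmt) : ∀ s : Stmt, sizeOf s < sizeOf D → NoOcc D s := by
  intro s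
  induction s with
  | skip => intro _; trivial
  | assign x e => intro _; trivial
  | seq a b iha ihb =>
    intro h; simp at h
    exact ⟨iha (by omega), ihb (by omega)⟩
  | demon a b iha ihb =>
    intro h
    refine ⟨fun hD => ?_, ?_⟩
    · rw [hD] at h; exact lt_irrefl _ h
    · simp at h
      exact ⟨iha (by omega), ihb (by omega)⟩
  | prob e a b iha ihb =>
    intro h; simp at h
    exact ⟨iha (by omega), ihb (by omega)⟩
  | ite e a b iha ihb =>
    intro h; simp at h
    exact ⟨iha (by omega), ihb (by omega)⟩
  | _ e a iha =>
    intro h; simp at h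
    exact iha (by omega)

/-- The policies agree away from `D`. -/
def Agree (D : Stmt) (π π' : Policy) : Prop :=
  ∀ (ε : Valuation) (s : Stmt), s ≠ D → π (ε, s) = π' (ε, s)

theorem step_transfer {D : Stmt} {π π' : Policy} (hag : Agree D π π') {σ σ' : State} {p : ℝ}
    (h : Step π σ p σ') : NoOcc D σ.2 → Step π' σ p σ' ∧ NoOcc D σ'.2 := by
  induction h with
  | assign => intro _; exact ⟨.assign, trivial⟩
  | seqSkip _ ih => intro hn; exact ⟨.seqSkip (ih hn.2).1, (ih hn.2).2⟩
  | seqStep _ ih => intro hn; exact ⟨.seqStep (ih hn.1).1, (ih hn.1).2, hn.2⟩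
  | demonL hπ => intro hn; exact ⟨.demonL ((hag _ _ hn.1).symm.trans hπ), hn.2.1⟩
  | demonR hπ => intro hn; exact ⟨.demonR ((hag _ _ hn.1).symm.trans hπ), hn.2.2⟩
  | iteT he => intro hn; exact ⟨.iteT he, hn.1⟩
  | iteF he => intro hn; exact ⟨.iteF he, hn.2⟩
  | probL h0 h1 => intro hn; exact ⟨.probL h0 h1, hn.1⟩
  | probR h0 h1 => intro hn; exact ⟨.probR h0 h1, hn.2⟩
  | whileT he => intro hn; exact ⟨.whileT he, hn, hn⟩
  | whileF he => intro _; exact ⟨.whileF he, trivial⟩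

/-- Transfer of paths between policies agreeing away from `D`. -/
def transfer {D : Stmt} {π π' : Policy} (hag : Agree D π π') :
    {σ : State} → Paths π σ → NoOcc D σ.2 → Paths π' σ
  | _, .nil ε, _ => .nil ε
  | _, .cons p h rest, hn =>
    .cons p (step_transfer hag h hn).1 (transfer hag rest (step_transfer hag h hn).2)

theorem transfer_transfer {D : Stmt} {π π' : Policy} (hag : Agree D π π') (hag' : Agree D π' π)
    {σ : State} (ρ : Paths π σ) (hn : NoOcc D σ.2) :
    transfer hag' (transfer hag ρ hn) hn = ρ := by
  induction ρ with
  | nil ε => rfl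
  | cons p h rest ih => simp [transfer, ih]

theorem transfer_prob {D : Stmt} {π π' : Policy} (hag : Agree D π π')
    {σ : State} (ρ : Paths π σ) (hn : NoOcc D σ.2) :
    (transfer hag ρ hn).prob = ρ.prob ∧ (transfer hag ρ hn).finalVal = ρ.finalVal := by
  induction ρ with
  | nil ε => exact ⟨rfl, rfl⟩
  | cons p h rest ih =>
    simp [transfer, Paths.prob, Paths.finalVal, ih]

theorem expVal_transfer {D : Stmt} {π π' : Policy} (hag : Agree D π π')
    {σ : State} (hn : NoOcc D σ.2) (r : Valuation → ℝ) : expVal π' σ r = expVal π σ r := by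
  have hag' : Agree D π' π := fun ε s hs => (hag ε s hs).symm
  let e : Paths π σ ≃ Paths π' σ :=
    { toFun := fun ρ => transfer hag ρ hn
      invFun := fun ρ => transfer hag' ρ hn
      left_inv := fun ρ => transfer_transfer hag hag' ρ hn
      right_inv := fun ρ => transfer_transfer hag' hag ρ hn }
  unfold expVal
  rw [← e.tsum_eq]
  refine tsum_congr fun ρ => ?_
  change (transfer hag ρ hn).prob * r (transfer hag ρ hn).finalVal = _
  rw [(transfer_prob hag ρ hn).1, (transfer_prob hag ρ hn).2]

theorem expVal_demonL {π : Policy} {ε : Valuation} {s₁ s₂ : Stmt}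
    (h : π (ε, .demon s₁ s₂) = true) (r : Valuation → ℝ) :
    expVal π (ε, .demon s₁ s₂) r = expVal π (ε, s₁) r := by
  let f : Paths π (ε, s₁) → Paths π (ε, .demon s₁ s₂) := fun ρ => .cons 1 (.demonL h) ρ
  have hf : Function.Bijective f := by
    constructor
    · intro a b hab
      simpa [f] using hab
    · intro ρ
      cases ρ with
      | cons p hs rest =>
        cases hs with
        | demonL _ => exact ⟨rest, rfl⟩
        | demonR h' => rw [h] at h'; cases h'
  unfold expVal
  rw [← (Equiv.ofBijective f hf).tsum_eq]
  refine tsum_congr fun ρ => ?_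
  simp [f, Paths.prob, Paths.finalVal]

theorem expVal_demonR {π : Policy} {ε : Valuation} {s₁ s₂ : Stmt}
    (h : π (ε, .demon s₁ s₂) = false) (r : Valuation → ℝ) :
    expVal π (ε, .demon s₁ s₂) r = expVal π (ε, s₂) r := by
  let f : Paths π (ε, s₂) → Paths π (ε, .demon s₁ s₂) := fun ρ => .cons 1 (.demonR h) ρ
  have hf : Function.Bijective f := by
    constructor
    · intro a b hab
      simpa [f] using hab
    · intro ρ
      cases ρ with
      | cons p hs rest =>
        cases hs with
        | demonR _ => exact ⟨rest, rfl⟩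
        | demonL h' => rw [h] at h'; cases h'
  unfold expVal
  rw [← (Equiv.ofBijective f hf).tsum_eq]
  refine tsum_congr fun ρ => ?_
  simp [f, Paths.prob, Paths.finalVal]

theorem step_nonneg {π : Policy} {σ σ' : State} {p : ℝ} (h : Step π σ p σ') : 0 ≤ p := by
  induction h <;> first | assumption | linarith

theorem prob_nonneg {π : Policy} {σ : State} (ρ : Paths π σ) : 0 ≤ ρ.prob := by
  induction ρ with
  | nil ε => exact zero_le_one
  | cons p h rest ih => exact mul_nonneg (step_nonneg h) ih

theorem bddBelow_expVal (σ : State) (φ : Valuation → Prop) :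
    BddBelow (Set.range fun π : Policy => expVal π σ (char φ)) := by
  refine ⟨0, ?_⟩
  rintro _ ⟨π, rfl⟩
  refine tsum_nonneg fun ρ => mul_nonneg (prob_nonneg ρ) ?_
  unfold char
  split_ifs <;> norm_num

/-- (Demonic choice) `ε ⊨ [s₁]_p φ` and `ε ⊨ [s₂]_p φ` iff `ε ⊨ [s₁ ⊓ s₂]_p φ`. -/
theorem pDL_demonic_choice (ε : Valuation) (s₁ s₂ : Stmt) (p : Valuation → ℝ)
    (hp : ∀ ε' : Valuation, 0 ≤ p ε' ∧ p ε' ≤ 1) (φ : Valuation → Prop) :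
    (sat ε s₁ p φ ∧ sat ε s₂ p φ) ↔ sat ε (.demon s₁ s₂) p φ := by
  classical
  unfold sat expectation
  constructor
  · rintro ⟨h1, h2⟩
    refine le_ciInf fun π => ?_
    cases hπ : π (ε, .demon s₁ s₂) with
    | true =>
      rw [expVal_demonL hπ]
      exact h1.trans (ciInf_le (bddBelow_expVal _ φ) π)
    | false =>
      rw [expVal_demonR hπ]
      exact h2.trans (ciInf_le (bddBelow_expVal _ φ) π)
  · intro h
    have key : ∀ (π : Policy) (b : Bool), Agree (.demon s₁ s₂) π
        (Function.update π (ε, .demon s₁ s₂) b) := by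
      intro π b ε' s hs
      rw [Function.update_of_ne]
      intro heq
      exact hs (congrArg Prod.snd heq)
    constructor
    · refine le_ciInf fun π => ?_
      have hn : NoOcc (.demon s₁ s₂) s₁ := noOcc_of_size _ _ (by simp; omega)
      rw [← expVal_transfer (key π true) (σ := (ε, s₁)) hn,
        ← expVal_demonL (s₂ := s₂) (Function.update_self _ _ _)]
      exact h.trans (ciInf_le (bddBelow_expVal _ φ) _)
    · refine le_ciInf fun π => ?_
      have hn : NoOcc (.demon s₁ s₂) s₂ := noOcc_of_size _ _ (by simp)
      rw [← expVal_transfer (key π false) (σ := (ε, s₂)) hn,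
        ← expVal_demonR (s₁ := s₁) (Function.update_self _ _ _)]
      exact h.trans (ciInf_le (bddBelow_expVal _ φ) _)

end PDL
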